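/- Let X be a nonempty shift of finite type with entropy h(X) = log λ, let 𝒵_n ⊆ Ω_n be the event that X_ω has zero topological entropy, and let I_n(ω) be the number of irreducible components of X_ω. Then for every α with 0 ≤ α < 1/λ: (1) lim_{n→∞} ℙ(𝒵_n) = 1; (2) the sequence (I_n) converges in distribution to the ℤ_{≥0}-valued random variable I_∞ with ℙ(I_∞ = 0) = (ζ_X(α))^{-1} and, for every k ≥ 1, ℙ(I_∞ = k) = (ζ_X(α))^{-1} ∑_{S ⊆ ℕ, |S| = k} ∏_{s ∈ S} α^{|γ_s|}/(1 − α^{|γ_s|}), where {γ_i}_{i=1}^∞ is an enumeration of the periodic orbits of X and |γ_s| is the cardinality of the orbit γ_s; (3) I_∞ has exponentially decreasing tail, i.e., for every δ > 0 there exists k_0 such that ℙ(I_∞ = k+1) ≤ δ·ℙ(I_∞ = k) for all k ≥ k_0, and hence I_∞ has finite moments of all orders. -/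

import Mathlib

open Filter Topology
open scoped Classical

noncomputable section

variable {A : Type*}

/-- The left shift map on bi-infinite sequences over the alphabet `A`. -/
def shiftMap (x : ℤ → A) : ℤ → A := fun i => x (i + 1)

/-- The word `w` of length `n` occurs in the bi-infinite sequence `x`. -/
def OccursIn {n : ℕ} (w : Fin n → A) (x : ℤ → A) : Prop :=
  ∃ i : ℤ, ∀ j : Fin n, x (i + ((j : ℕ) : ℤ)) = w j

/-- `X` is a shift of finite type: the set of bi-infinite sequences avoiding a
finite set `F` of forbidden words. -/
def IsSFT (X : Set (ℤ → A)) : Prop :=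
  ∃ F : Set ((n : ℕ) × (Fin n → A)), F.Finite ∧
    X = {x | ∀ w ∈ F, ¬ OccursIn w.2 x}

/-- `B_n(X)`: the set of words of length `n` appearing in points of `X`. -/
def wordsOf (X : Set (ℤ → A)) (n : ℕ) : Set (Fin n → A) :=
  {w | ∃ x ∈ X, OccursIn w x}

/-- The length-`n` subword of `x` starting at position `i`. -/
def subword (x : ℤ → A) (i : ℤ) (n : ℕ) : Fin n → A :=
  fun j => x (i + ((j : ℕ) : ℤ))

/-- The random SFT `X_ω`: points of `X` all of whose length-`n` subwords are
allowed by `ω` (a word `w` is allowed iff `ω w = true`). -/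
def XRes (X : Set (ℤ → A)) {n : ℕ} (ω : (Fin n → A) → Bool) : Set (ℤ → A) :=
  {x | x ∈ X ∧ ∀ i : ℤ, ω (subword x i n) = true}

/-- The probability of the event `Ev` when each coordinate in `E` is chosen to be
`true` independently with probability `α` (i.i.d. Bernoulli(α) coins). -/
def bprob {E : Type*} [Fintype E] [DecidableEq E] (α : ℝ) (Ev : Set (E → Bool)) : ℝ :=
  ∑ ω : E → Bool,
    if ω ∈ Ev then
      α ^ (Finset.univ.filter fun e => ω e = true).card *
        (1 - α) ^ (Finset.univ.filter fun e => ω e = false).card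
    else 0

/-- `N_p`: the number of points of `X` fixed by the `p`-th power of the shift. -/
def periodicCount (X : Set (ℤ → A)) (p : ℕ) : ℕ :=
  Nat.card {x : ℤ → A // x ∈ X ∧ shiftMap^[p] x = x}

/-- The Artin–Mazur zeta function `ζ_X(t) = exp (∑_{p ≥ 1} N_p t^p / p)`. -/
def zetaX (X : Set (ℤ → A)) (t : ℝ) : ℝ :=
  Real.exp (∑' p : ℕ, (periodicCount X (p + 1) : ℝ) / (p + 1) * t ^ (p + 1))

end

noncomputable section

variable {A : Type*}

/-- A subshift: a closed, shift-invariant subset of the full shift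
(`A` carries the discrete topology, `ℤ → A` the product topology). -/
def IsSubshift [TopologicalSpace A] (X : Set (ℤ → A)) : Prop :=
  IsClosed X ∧ shiftMap '' X = X

/-- Irreducibility: for every two open sets `U`, `V` meeting `X` and every `N`,
there exists `n ≥ N` with `σ^n(U ∩ X) ∩ (V ∩ X) ≠ ∅`. -/
def IsIrredSubshift [TopologicalSpace A] (X : Set (ℤ → A)) : Prop :=
  IsSubshift X ∧
    ∀ U V : Set (ℤ → A), IsOpen U → IsOpen V →
      (X ∩ U).Nonempty → (X ∩ V).Nonempty →
        ∀ N : ℕ, ∃ m ≥ N, ((shiftMap^[m]) '' (X ∩ U) ∩ (X ∩ V)).Nonempty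

/-- `C` is an irreducible component of `Y`: a nonempty maximal irreducible SFT
contained in `Y`. -/
def IsIrredComponent [TopologicalSpace A] (Y C : Set (ℤ → A)) : Prop :=
  C.Nonempty ∧ IsSFT C ∧ C ⊆ Y ∧ IsIrredSubshift C ∧
    ∀ C' : Set (ℤ → A), IsSFT C' → C' ⊆ Y → IsIrredSubshift C' → C ⊆ C' → C' = C

/-- The number of irreducible components of `Y`. -/
def compCount [TopologicalSpace A] (Y : Set (ℤ → A)) : ℕ :=
  Nat.card {C : Set (ℤ → A) // IsIrredComponent Y C}

/-- The topological entropy of a subshift, via `h(Y) = inf_n (1/n) log |B_n(Y)|`. -/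
def subEntropy (Y : Set (ℤ → A)) : ℝ :=
  ⨅ n : ℕ, Real.log ((wordsOf Y (n + 1)).ncard) / (n + 1)

/-- `O` is a periodic orbit of `X`. -/
def IsPeriodicOrbit (X : Set (ℤ → A)) (O : Set (ℤ → A)) : Prop :=
  ∃ x, x ∈ X ∧ (∃ p : ℕ, 1 ≤ p ∧ shiftMap^[p] x = x) ∧
    O = Set.range fun m : ℕ => shiftMap^[m] x

end

section Periodic

variable {A : Type*}

lemma shiftMap_iterate_apply (m : ℕ) (x : ℤ → A) (i : ℤ) :
    shiftMap^[m] x i = x (i + m) := by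
  induction m generalizing x with
  | zero => simp
  | succ k ih =>
    rw [Function.iterate_succ_apply, ih]
    simp only [shiftMap]
    congr 1
    push_cast
    ring

lemma shiftMap_iterate_eq_iff (p : ℕ) (x : ℤ → A) :
    shiftMap^[p] x = x ↔ Function.Periodic x (p : ℤ) := by
  constructor
  · intro h i
    rw [← shiftMap_iterate_apply p x i, h]
  · intro h
    funext i
    rw [shiftMap_iterate_apply, h i]

lemma Function.Periodic.apply_emod {x : ℤ → A} {M : ℤ} (h : Function.Periodic x M) (i t : ℤ) :
    x (i + (t - i) % M) = x t := by
  have h1 := h.int_mul ((t - i) / M) (i + (t - i) % M)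
  rw [← h1]
  congr 1
  have := Int.emod_add_mul_ediv (t - i) M
  simp only [Int.cast_id]
  linarith [mul_comm M ((t - i) / M)]

lemma Function.Periodic.of_dvd {x : ℤ → A} {p M : ℕ} (h : Function.Periodic x (p : ℤ))
    (hd : p ∣ M) : Function.Periodic x (M : ℤ) := by
  obtain ⟨c, rfl⟩ := hd
  have := h.nat_mul c
  rw [mul_comm] at this
  exact_mod_cast this

lemma Function.Periodic.shiftMap_iterate {x : ℤ → A} {M : ℤ} (h : Function.Periodic x M) (m : ℕ) :
    Function.Periodic (shiftMap^[m] x) M := by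
  intro i
  rw [shiftMap_iterate_apply, shiftMap_iterate_apply, ← h (i + m)]
  congr 1
  ring

lemma subword_shiftMap_iterate (x : ℤ → A) (m : ℕ) (i : ℤ) (n : ℕ) :
    subword (shiftMap^[m] x) i n = subword x (i + m) n := by
  funext j
  simp only [subword, shiftMap_iterate_apply]
  congr 1
  ring

lemma subword_eq_iff (x y : ℤ → A) (i j : ℤ) (n : ℕ) :
    subword x i n = subword y j n ↔ ∀ k : ℤ, 0 ≤ k → k < n → x (i + k) = y (j + k) := by
  constructor
  · intro h k h0 h1
    have := congrFun h ⟨k.toNat, by omega⟩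
    simp only [subword] at this
    rwa [Int.toNat_of_nonneg h0] at this
  · intro h
    funext k
    exact h _ (by positivity) (by exact_mod_cast k.2)

/-- A periodic point is determined by any of its subwords that covers a period. -/
lemma eq_of_subword_eq {x y : ℤ → A} {M n : ℕ} (hM : 1 ≤ M) (hMn : M ≤ n)
    (hx : Function.Periodic x (M : ℤ)) (hy : Function.Periodic y (M : ℤ)) {i : ℤ}
    (h : subword x i n = subword y i n) : x = y := by
  funext t
  rw [← hx.apply_emod i t, ← hy.apply_emod i t]
  have h0 := Int.emod_nonneg (t - i) (show (M : ℤ) ≠ 0 by omega)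
  have h1 := Int.emod_lt_of_pos (t - i) (show (0 : ℤ) < M by omega)
  exact (subword_eq_iff _ _ _ _ _).1 h _ h0 (by omega)

/-- The `L`-periodic sequence that agrees with `x` on `[i, i + L)`. -/
def periodicExt (x : ℤ → A) (i : ℤ) (L : ℕ) : ℤ → A := fun t => x (i + (t - i) % (L : ℤ))

lemma periodicExt_periodic (x : ℤ → A) (i : ℤ) (L : ℕ) :
    Function.Periodic (periodicExt x i L) (L : ℤ) := by
  intro t
  simp only [periodicExt]
  rw [show t + (L : ℤ) - i = t - i + L by ring, Int.add_emod_right]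

lemma periodicExt_eq {x : ℤ → A} {i : ℤ} {L n : ℕ} (hL : 1 ≤ L)
    (h : subword x i n = subword x (i + L) n) {t : ℤ} (h0 : i ≤ t) (h1 : t < i + L + n) :
    periodicExt x i L t = x t := by
  obtain ⟨k, rfl⟩ : ∃ k : ℕ, t = i + k := ⟨(t - i).toNat, by omega⟩
  induction k using Nat.strong_induction_on with
  | _ k ih =>
    by_cases hk : k < L
    · simp only [periodicExt]
      rw [show i + (k : ℤ) - i = k by ring, Int.emod_eq_of_lt (by omega) (by omega)]
    · have h2 := ih (k - L) (by omega) (by omega) (by omega)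
      have h3 := periodicExt_periodic x i L (i + ((k - L : ℕ) : ℤ))
      rw [show i + ((k - L : ℕ) : ℤ) + L = i + k by omega] at h3
      rw [h3, h2, (subword_eq_iff _ _ _ _ _).1 h _ (by omega) (by omega)]
      congr 1
      omega

/-- The points of `Y` are exactly the sequences all of whose subwords of length `n` occur
in `Y`. -/
def StepClosed (Y : Set (ℤ → A)) (n : ℕ) : Prop :=
  ∀ z : ℤ → A, (∀ i, ∃ y ∈ Y, ∃ j, subword z i n = subword y j n) → z ∈ Y

lemma StepClosed.periodicExt_mem {Y : Set (ℤ → A)} {n : ℕ} (hY : StepClosed Y n)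
    {x : ℤ → A} (hx : x ∈ Y) {i : ℤ} {L : ℕ} (hL : 1 ≤ L)
    (h : subword x i n = subword x (i + L) n) : periodicExt x i L ∈ Y := by
  refine hY _ fun t => ⟨x, hx, i + (t - i) % L, ?_⟩
  rw [subword_eq_iff]
  intro k h0 h1
  have e0 := Int.emod_nonneg (t - i) (show (L : ℤ) ≠ 0 by omega)
  have e1 := Int.emod_lt_of_pos (t - i) (show (0 : ℤ) < L by omega)
  rw [← periodicExt_eq hL h (by omega) (by omega)]
  simp only [periodicExt]
  congr 2
  rw [show i + (t - i) % (L : ℤ) + k - i = k + (t - i) % L by ring,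
    show t + k - i = k + (t - i) by ring, Int.add_emod_emod]

lemma StepClosed.shiftMap_iterate_mem {Y : Set (ℤ → A)} {n : ℕ} (hY : StepClosed Y n)
    {x : ℤ → A} (hx : x ∈ Y) (m : ℕ) : shiftMap^[m] x ∈ Y :=
  hY _ fun i => ⟨x, hx, i + m, subword_shiftMap_iterate x m i n⟩

/-- If all simple cycles of `Y` have period `M`, then so do all its periodic points. -/
lemma StepClosed.periodic_of_simple {Y : Set (ℤ → A)} {n M : ℕ} (hY : StepClosed Y n)
    (hM : 1 ≤ M) (hMn : M ≤ n)
    (hs : ∀ z ∈ Y, ∀ p : ℕ, 1 ≤ p → Function.Periodic z (p : ℤ) →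
      (∀ i j : ℕ, i < j → j < p → subword z i n ≠ subword z j n) →
      Function.Periodic z (M : ℤ))
    (L : ℕ) (hL : 1 ≤ L) (z : ℤ → A) (hz : z ∈ Y) (hzL : Function.Periodic z (L : ℤ)) :
    Function.Periodic z (M : ℤ) := by
  induction L using Nat.strong_induction_on generalizing z with
  | _ L ih =>
    by_cases hinj : ∀ i j : ℕ, i < j → j < L → subword z i n ≠ subword z j n
    · exact hs z hz L hL hzL hinj
    push Not at hinj
    obtain ⟨i, j, hij, hjL, hw⟩ := hinj
    have hw1 : subword z (i : ℤ) n = subword z ((i : ℤ) + ((j - i : ℕ) : ℤ)) n := by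
      rw [hw]; congr 1; omega
    have hw2 : subword z (j : ℤ) n = subword z ((j : ℤ) + ((L - (j - i) : ℕ) : ℤ)) n := by
      rw [← hw, subword_eq_iff]
      intro k _ _
      rw [← hzL]
      congr 1
      omega
    set a := periodicExt z i (j - i) with ha
    set b := periodicExt z j (L - (j - i)) with hb
    have haM : Function.Periodic a (M : ℤ) :=
      ih (j - i) (by omega) (by omega) a (hY.periodicExt_mem hz (by omega) hw1)
        (periodicExt_periodic _ _ _)
    have hbM : Function.Periodic b (M : ℤ) :=
      ih (L - (j - i)) (by omega) (by omega) b (hY.periodicExt_mem hz (by omega) hw2)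
        (periodicExt_periodic _ _ _)
    have haz : ∀ t : ℤ, i ≤ t → t < j + n → a t = z t := fun t h0 h1 =>
      periodicExt_eq (by omega) hw1 h0 (by omega)
    have hbz : ∀ t : ℤ, j ≤ t → t < i + L + n → b t = z t := fun t h0 h1 =>
      periodicExt_eq (by omega) hw2 h0 (by omega)
    have hab : a = b := by
      refine eq_of_subword_eq (i := j) hM hMn haM hbM ?_
      rw [subword_eq_iff]
      intro k h0 h1
      rw [haz _ (by omega) (by omega), hbz _ (by omega) (by omega)]
    have hza : ∀ t : ℤ, i ≤ t → t < i + L + n → a t = z t := by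
      intro t h0 h1
      by_cases ht : t < j
      · exact haz t h0 (by omega)
      · rw [hab]; exact hbz t (by omega) h1
    intro u
    have e0 := Int.emod_nonneg (u - i) (show (L : ℤ) ≠ 0 by omega)
    have e1 := Int.emod_lt_of_pos (u - i) (show (0 : ℤ) < L by omega)
    rw [← hzL.apply_emod i u]
    have h1 : z (u + M) = z (i + (u - i) % L + M) := by
      have hp := hzL.int_mul ((u - i) / L) (i + (u - i) % L + M)
      rw [← hp]
      congr 1
      have := Int.emod_add_mul_ediv (u - i) L
      simp only [Int.cast_id]
      linarith [mul_comm (L : ℤ) ((u - i) / L)]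
    rw [h1, ← hza _ (by omega) (by omega), haM, hza _ (by omega) (by omega)]

/-- If all periodic points of `Y` have period `M`, then a point of `Y` is `M`-periodic between
two occurrences of the same word of length `n`. -/
lemma StepClosed.apply_add_eq {Y : Set (ℤ → A)} {n M : ℕ} (hY : StepClosed Y n)
    (hper : ∀ z ∈ Y, ∀ p : ℕ, 1 ≤ p → Function.Periodic z (p : ℤ) →
      Function.Periodic z (M : ℤ))
    {x : ℤ → A} (hx : x ∈ Y) {i j : ℤ} (hij : i < j) (h : subword x i n = subword x j n)
    {t : ℤ} (h0 : i ≤ t) (h1 : t + M < j + n) : x (t + M) = x t := by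
  obtain ⟨L, hL⟩ : ∃ L : ℕ, j = i + L := ⟨(j - i).toNat, by omega⟩
  subst hL
  have hL1 : 1 ≤ L := by omega
  have hp := hper _ (hY.periodicExt_mem hx hL1 h) L hL1 (periodicExt_periodic _ _ _)
  rw [← periodicExt_eq hL1 h h0 (by omega), ← periodicExt_eq hL1 h (t := t + M) (by omega) h1,
    hp]

end Periodic

section Orbits

variable {A : Type*}

lemma StepClosed.isSFT [Finite A] {Y : Set (ℤ → A)} {n : ℕ} (hY : StepClosed Y n) : IsSFT Y := by
  refine ⟨(fun w : Fin n → A => (⟨n, w⟩ : (n : ℕ) × (Fin n → A))) '' (wordsOf Y n)ᶜ,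
    (Set.toFinite _).image _, ?_⟩
  ext z
  simp only [Set.mem_ofPred_eq, Set.forall_mem_image, Set.mem_compl_iff]
  constructor
  · intro hz w hw ho
    exact hw ⟨z, hz, ho⟩
  · intro h
    refine hY z fun i => ?_
    by_contra hc
    refine h (x := subword z i n) ?_ ⟨i, fun j => rfl⟩
    rintro ⟨y, hy, j, hj⟩
    exact hc ⟨y, hy, j, funext fun k => (hj k).symm⟩

lemma IsSFT.exists_stepClosed {X : Set (ℤ → A)} (hX : IsSFT X) :
    ∃ L : ℕ, ∀ n ≥ L, StepClosed X n := by
  obtain ⟨F, hF, rfl⟩ := hX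
  obtain ⟨L, hL⟩ := (hF.image Sigma.fst).bddAbove
  refine ⟨L, fun n hn z hz w hw ⟨i, hi⟩ => ?_⟩
  obtain ⟨y, hy, j, hj⟩ := hz i
  have hwn : w.1 ≤ n := (hL (Set.mem_image_of_mem _ hw)).trans hn
  refine hy w hw ⟨j, fun k => ?_⟩
  rw [← hi k]
  exact ((subword_eq_iff _ _ _ _ _).1 hj k (by positivity)
    (by have := k.2; omega)).symm

lemma StepClosed.xRes {X : Set (ℤ → A)} {n : ℕ} (hX : StepClosed X n)
    (ω : (Fin n → A) → Bool) : StepClosed (XRes X ω) n := by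
  intro z hz
  refine ⟨hX z fun i => ?_, fun i => ?_⟩
  · obtain ⟨y, hy, j, hj⟩ := hz i
    exact ⟨y, hy.1, j, hj⟩
  · obtain ⟨y, hy, j, hj⟩ := hz i
    rw [hj]
    exact hy.2 j

lemma isOpen_subword_eq [TopologicalSpace A] [DiscreteTopology A] (c : ℤ → A) (i : ℤ) (n : ℕ) :
    IsOpen {y : ℤ → A | subword y i n = subword c i n} := by
  have hc : Continuous fun y : ℤ → A => subword y i n :=
    continuous_pi fun j => continuous_apply _
  exact (isOpen_discrete {subword c i n}).preimage hc

lemma StepClosed.isClosed [TopologicalSpace A] [DiscreteTopology A] {Y : Set (ℤ → A)} {n : ℕ}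
    (hY : StepClosed Y n) : IsClosed Y := by
  refine isClosed_of_closure_subset fun z hz => hY z fun i => ?_
  obtain ⟨y, hy, hyY⟩ := mem_closure_iff.1 hz _ (isOpen_subword_eq z i n) rfl
  exact ⟨y, hyY, i, hy.symm⟩

lemma range_iterate_eq_of_mem {x y : ℤ → A} {p : ℕ} (hp : 1 ≤ p) (hx : shiftMap^[p] x = x)
    (hy : y ∈ Set.range fun m : ℕ => shiftMap^[m] x) :
    (Set.range fun m : ℕ => shiftMap^[m] x) = Set.range fun m : ℕ => shiftMap^[m] y := by
  obtain ⟨m, rfl⟩ := hy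
  have hback : shiftMap^[m * p - m] (shiftMap^[m] x) = x := by
    rw [← Function.iterate_add_apply, Nat.sub_add_cancel (Nat.le_mul_of_pos_right m hp)]
    exact Function.IsPeriodicPt.const_mul (f := shiftMap) (x := x) (m := p) hx m
  ext z
  constructor
  · rintro ⟨r, rfl⟩
    refine ⟨r + (m * p - m), ?_⟩
    simp only [Function.iterate_add_apply]
    rw [hback]
  · rintro ⟨r, rfl⟩
    exact ⟨r + m, by simp only [Function.iterate_add_apply]⟩

lemma IsPeriodicOrbit.eq_range {X O : Set (ℤ → A)} (hO : IsPeriodicOrbit X O) {y : ℤ → A}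
    (hy : y ∈ O) : O = Set.range fun m : ℕ => shiftMap^[m] y := by
  obtain ⟨x, -, ⟨p, hp, hx⟩, rfl⟩ := hO
  exact range_iterate_eq_of_mem hp hx hy

lemma IsPeriodicOrbit.nonempty {X O : Set (ℤ → A)} (hO : IsPeriodicOrbit X O) : O.Nonempty := by
  obtain ⟨x, -, -, rfl⟩ := hO
  exact ⟨x, 0, rfl⟩

lemma IsPeriodicOrbit.exists_period {X O : Set (ℤ → A)} (hO : IsPeriodicOrbit X O) :
    ∃ p : ℕ, 1 ≤ p ∧ ∀ y ∈ O, Function.Periodic y (p : ℤ) := by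
  obtain ⟨x, -, ⟨p, hp, hx⟩, rfl⟩ := hO
  refine ⟨p, hp, ?_⟩
  rintro _ ⟨m, rfl⟩
  exact ((shiftMap_iterate_eq_iff p x).1 hx).shiftMap_iterate m

lemma IsPeriodicOrbit.subset {X O : Set (ℤ → A)} {n : ℕ} (hX : StepClosed X n)
    (hO : IsPeriodicOrbit X O) : O ⊆ X := by
  obtain ⟨x, hx, -, rfl⟩ := hO
  rintro _ ⟨m, rfl⟩
  exact hX.shiftMap_iterate_mem hx m

lemma IsPeriodicOrbit.of_subset {X Y O : Set (ℤ → A)} (hO : IsPeriodicOrbit X O) (h : O ⊆ Y) :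
    IsPeriodicOrbit Y O := by
  obtain ⟨x, hx, hp, rfl⟩ := hO
  exact ⟨x, h ⟨0, rfl⟩, hp, rfl⟩

lemma IsPeriodicOrbit.stepClosed {X O : Set (ℤ → A)} (hO : IsPeriodicOrbit X O) {M : ℕ}
    (hM : 1 ≤ M) (hper : ∀ y ∈ O, Function.Periodic y (M : ℤ)) : StepClosed O (M + 1) := by
  intro z hz
  have hzM : Function.Periodic z (M : ℤ) := by
    intro t
    obtain ⟨y, hy, j, hj⟩ := hz t
    rw [subword_eq_iff] at hj
    rw [hj M (by omega) (by push_cast; omega), hper y hy]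
    simpa using (hj 0 le_rfl (by positivity)).symm
  obtain ⟨y, hy, j, hj⟩ := hz 0
  have hjM := Int.emod_nonneg j (show (M : ℤ) ≠ 0 by omega)
  have hzy : z = shiftMap^[(j % M).toNat] y := by
    refine eq_of_subword_eq (i := 0) hM (Nat.le_succ M) hzM ((hper y hy).shiftMap_iterate _) ?_
    rw [hj, subword_shiftMap_iterate, subword_eq_iff]
    intro k _ _
    rw [Int.toNat_of_nonneg hjM]
    have hp := (hper y hy).int_mul (j / M) (0 + j % M + k)
    rw [← hp]
    congr 1
    have := Int.emod_add_mul_ediv j M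
    simp only [Int.cast_id]
    linarith [mul_comm (M : ℤ) (j / M)]
  rw [hO.eq_range hy]
  exact ⟨_, hzy.symm⟩

lemma IsPeriodicOrbit.isIrredSubshift [TopologicalSpace A] [DiscreteTopology A]
    {X O : Set (ℤ → A)} (hO : IsPeriodicOrbit X O) : IsIrredSubshift O := by
  obtain ⟨p, hp, hper⟩ := hO.exists_period
  have hfix : ∀ y ∈ O, ∀ N : ℕ, shiftMap^[N * p] y = y := fun y hy N =>
    Function.IsPeriodicPt.const_mul (f := shiftMap) (x := y) (m := p)
      ((shiftMap_iterate_eq_iff p y).2 (hper y hy)) N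
  have hmem : ∀ y ∈ O, ∀ m : ℕ, shiftMap^[m] y ∈ O := fun y hy m => by
    rw [hO.eq_range hy]; exact ⟨m, rfl⟩
  refine ⟨⟨(hO.stepClosed hp hper).isClosed, ?_⟩, ?_⟩
  · ext z
    constructor
    · rintro ⟨y, hy, rfl⟩
      exact hmem y hy 1
    · intro hz
      refine ⟨shiftMap^[p - 1] z, hmem z hz _, ?_⟩
      rw [← Function.iterate_succ_apply' shiftMap, show (p - 1).succ = 1 * p by omega]
      exact hfix z hz 1
  · rintro U V - - ⟨u, huO, huU⟩ ⟨v, hvO, hvV⟩ N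
    rw [hO.eq_range huO] at hvO
    obtain ⟨r, hr⟩ := hvO
    refine ⟨r + N * p, by nlinarith, v, ⟨u, ⟨huO, huU⟩, ?_⟩, ?_, hvV⟩
    · rw [Function.iterate_add_apply, hfix u huO N]
      exact hr
    · rw [← hr]
      exact hmem u huO r

lemma IsIrredSubshift.isPeriodicOrbit [TopologicalSpace A] [DiscreteTopology A]
    {Y C : Set (ℤ → A)} {n M : ℕ} (hY : StepClosed Y n) (hM : 1 ≤ M) (hMn : M ≤ n)
    (hper : ∀ z ∈ Y, ∀ p : ℕ, 1 ≤ p → Function.Periodic z (p : ℤ) →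
      Function.Periodic z (M : ℤ))
    (hCY : C ⊆ Y) (hne : C.Nonempty) (hC : IsIrredSubshift C) : IsPeriodicOrbit Y C := by
  have hCper : ∀ c ∈ C, Function.Periodic c (M : ℤ) := by
    intro c hc u
    obtain ⟨m, hm, v, ⟨y, ⟨hyC, hyU⟩, rfl⟩, hvC, hvV⟩ :=
      hC.2 _ _ (isOpen_subword_eq c u (n + 1)) (isOpen_subword_eq c u (n + 1))
        ⟨c, hc, rfl⟩ ⟨c, hc, rfl⟩ 1
    simp only [Set.mem_ofPred_eq] at hyU hvV
    rw [subword_shiftMap_iterate, subword_eq_iff] at hvV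
    rw [subword_eq_iff] at hyU
    have hw : subword y u n = subword y (u + m) n := by
      rw [subword_eq_iff]
      intro k h0 h1
      rw [hyU k h0 (by push_cast; omega), hvV k h0 (by push_cast; omega)]
    have h2 := hY.apply_add_eq hper (hCY hyC) (show u < u + m by omega) hw (t := u) le_rfl
      (by omega)
    rw [← hyU M (by omega) (by push_cast; omega), h2]
    simpa using hyU 0 le_rfl (by positivity)
  obtain ⟨c, hc⟩ := hne
  refine ⟨c, hCY hc, ⟨M, hM, (shiftMap_iterate_eq_iff M c).2 (hCper c hc)⟩, ?_⟩
  ext z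
  constructor
  · intro hz
    obtain ⟨m, -, v, ⟨y, ⟨hyC, hyU⟩, rfl⟩, hvC, hvV⟩ :=
      hC.2 _ _ (isOpen_subword_eq c 0 n) (isOpen_subword_eq z 0 n)
        ⟨c, hc, rfl⟩ ⟨z, hz, rfl⟩ 0
    have h1 : y = c := eq_of_subword_eq hM hMn (hCper y hyC) (hCper c hc) hyU
    have h2 : shiftMap^[m] y = z := eq_of_subword_eq hM hMn (hCper _ hvC) (hCper z hz) hvV
    exact ⟨m, by rw [← h2, h1]⟩
  · rintro ⟨m, rfl⟩
    have hinv : ∀ y ∈ C, shiftMap y ∈ C := fun y hy => by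
      rw [← hC.1.2]; exact ⟨y, hy, rfl⟩
    induction m with
    | zero => exact hc
    | succ k ih =>
      simp only [Function.iterate_succ_apply']
      exact hinv _ ih

/-- If the periodic points of `Y` have a common period `M ≤ n`, then the irreducible components
of `Y` are its periodic orbits. -/
lemma StepClosed.isIrredComponent_iff [Finite A] [TopologicalSpace A] [DiscreteTopology A]
    {Y C : Set (ℤ → A)} {n M : ℕ} (hY : StepClosed Y n) (hM : 1 ≤ M) (hMn : M ≤ n)
    (hper : ∀ z ∈ Y, ∀ p : ℕ, 1 ≤ p → Function.Periodic z (p : ℤ) →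
      Function.Periodic z (M : ℤ)) :
    IsIrredComponent Y C ↔ IsPeriodicOrbit Y C := by
  constructor
  · rintro ⟨hne, -, hCY, hC, -⟩
    exact hC.isPeriodicOrbit hY hM hMn hper hCY hne
  · intro hC
    obtain ⟨p, hp, hCp⟩ := hC.exists_period
    refine ⟨hC.nonempty, (hC.stepClosed hp hCp).isSFT, hC.subset hY, hC.isIrredSubshift, ?_⟩
    intro C' _ hC'Y hC' hsub
    obtain ⟨c, hc⟩ := hC.nonempty
    have h' := hC'.isPeriodicOrbit hY hM hMn hper hC'Y ⟨c, hsub hc⟩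
    rw [hC.eq_range hc, h'.eq_range (hsub hc)]

lemma StepClosed.compCount_eq [Finite A] [TopologicalSpace A] [DiscreteTopology A]
    {Y : Set (ℤ → A)} {n M : ℕ} (hY : StepClosed Y n) (hM : 1 ≤ M) (hMn : M ≤ n)
    (hper : ∀ z ∈ Y, ∀ p : ℕ, 1 ≤ p → Function.Periodic z (p : ℤ) →
      Function.Periodic z (M : ℤ)) :
    compCount Y = Nat.card {O : Set (ℤ → A) // IsPeriodicOrbit Y O} := by
  unfold compCount
  simp only [hY.isIrredComponent_iff hM hMn hper]

end Orbits

section Entropy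

variable {A : Type*}

/-- The letters following the positions of `[i, i + m)` at which `x` fails to be `M`-periodic,
indexed by the words of length `n` that start at these positions. -/
noncomputable def breakCode (M n m : ℕ) (x : ℤ → A) (i : ℤ) (v : Fin n → A) : Option (Fin m × A) :=
  if h : ∃ b : Fin m, x (i + (b : ℕ) + M) ≠ x (i + (b : ℕ)) ∧ subword x (i + (b : ℕ)) n = v then
    some (h.choose, x (i + (h.choose : ℕ) + M)) else none

lemma StepClosed.breakCode_eq_some_iff {Y : Set (ℤ → A)} {n M m : ℕ} (hY : StepClosed Y n)
    (hMn : M ≤ n)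
    (hper : ∀ z ∈ Y, ∀ p : ℕ, 1 ≤ p → Function.Periodic z (p : ℤ) →
      Function.Periodic z (M : ℤ)) {x : ℤ → A} (hx : x ∈ Y) {i : ℤ} {v : Fin n → A} {b : Fin m}
    {a : A} :
    breakCode M n m x i v = some (b, a) ↔
      (x (i + (b : ℕ) + M) ≠ x (i + (b : ℕ)) ∧ subword x (i + (b : ℕ)) n = v) ∧
        x (i + (b : ℕ) + M) = a := by
  unfold breakCode
  constructor
  · intro h
    split_ifs at h with hb
    have hs := hb.choose_spec
    simp only [Option.some.injEq, Prod.mk.injEq] at h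
    obtain ⟨h1, h2⟩ := h
    rw [h1] at hs h2
    exact ⟨hs, h2⟩
  · rintro ⟨h1, rfl⟩
    have hb : ∃ b : Fin m, x (i + (b : ℕ) + M) ≠ x (i + (b : ℕ)) ∧
        subword x (i + (b : ℕ)) n = v := ⟨b, h1⟩
    have hs := hb.choose_spec
    rw [dif_pos hb]
    have hbb : hb.choose = b := by
      by_contra hne
      rcases lt_or_gt_of_ne (fun h => hne (Fin.ext h) : (hb.choose : ℕ) ≠ b) with hlt | hlt
      · exact hs.1 (hY.apply_add_eq hper hx (show i + (hb.choose : ℕ) < i + (b : ℕ) by omega)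
          (hs.2.trans h1.2.symm) le_rfl (by omega))
      · exact h1.1 (hY.apply_add_eq hper hx (show i + (b : ℕ) < i + (hb.choose : ℕ) by omega)
          (h1.2.trans hs.2.symm) le_rfl (by omega))
    rw [hbb]

lemma StepClosed.ncard_wordsOf_le [Fintype A] {Y : Set (ℤ → A)} {n M : ℕ} (hY : StepClosed Y n)
    (hM : 1 ≤ M) (hMn : M ≤ n)
    (hper : ∀ z ∈ Y, ∀ p : ℕ, 1 ≤ p → Function.Periodic z (p : ℤ) →
      Function.Periodic z (M : ℤ)) (m : ℕ) :
    (wordsOf Y m).ncard ≤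
      Fintype.card A ^ M * (m * Fintype.card A + 1) ^ Fintype.card (Fin n → A) := by
  have hwit : ∀ w : wordsOf Y m, ∃ x : ℤ → A, ∃ i : ℤ, x ∈ Y ∧ ∀ k : Fin m, x (i + (k : ℕ)) = w.1 k :=
    fun ⟨w, x, hx, i, hi⟩ => ⟨x, i, hx, hi⟩
  choose x i hx hi using hwit
  let f : wordsOf Y m → (Fin M → A) × ((Fin n → A) → Option (Fin m × A)) :=
    fun w => (subword (x w) (i w) M, breakCode M n m (x w) (i w))
  have hf : Function.Injective f := by
    intro w w' hww
    simp only [f, Prod.mk.injEq] at hww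
    obtain ⟨h1, h2⟩ := hww
    have key : ∀ w w' : wordsOf Y m, breakCode M n m (x w) (i w) = breakCode M n m (x w') (i w') →
        ∀ b : Fin m, x w (i w + (b : ℕ) + M) ≠ x w (i w + (b : ℕ)) →
          x w (i w + (b : ℕ) + M) = x w' (i w' + (b : ℕ) + M) := by
      intro w w' h b hb
      have e1 := (hY.breakCode_eq_some_iff hMn hper (hx w)).2 ⟨⟨hb, rfl⟩, rfl⟩
      rw [h] at e1
      exact ((hY.breakCode_eq_some_iff hMn hper (hx w')).1 e1).2.symm
    have hall : ∀ k : ℕ, k < m → x w (i w + k) = x w' (i w' + k) := by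
      intro k
      induction k using Nat.strong_induction_on with
      | _ k ih =>
        intro hk
        by_cases hkM : k < M
        · exact (subword_eq_iff _ _ _ _ _).1 h1 k (by omega) (by omega)
        · obtain ⟨b, rfl⟩ : ∃ b, k = b + M := ⟨k - M, by omega⟩
          have hbm : b < m := by omega
          have e1 := key w w' h2 ⟨b, hbm⟩
          have e2 := key w' w h2.symm ⟨b, hbm⟩
          have e3 := ih b (by omega) hbm
          push_cast
          simp only [← add_assoc]
          by_cases hb : x w (i w + (b : ℕ) + M) = x w (i w + (b : ℕ))
          · by_cases hb' : x w' (i w' + (b : ℕ) + M) = x w' (i w' + (b : ℕ))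
            · rw [hb, hb', e3]
            · exact (e2 hb').symm
          · exact e1 hb
    apply Subtype.ext
    funext k
    rw [← hi w k, ← hi w' k]
    exact hall k k.2
  have hcard := Nat.card_le_card_of_injective f hf
  rw [Nat.card_coe_set_eq] at hcard
  refine hcard.trans (le_of_eq ?_)
  simp [Nat.card_eq_fintype_card]

lemma StepClosed.subEntropy_eq_zero [Fintype A] {Y : Set (ℤ → A)} {n M : ℕ}
    (hY : StepClosed Y n) (hM : 1 ≤ M) (hMn : M ≤ n)
    (hper : ∀ z ∈ Y, ∀ p : ℕ, 1 ≤ p → Function.Periodic z (p : ℤ) →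
      Function.Periodic z (M : ℤ)) : subEntropy Y = 0 := by
  have hnn : ∀ m : ℕ, 0 ≤ Real.log ((wordsOf Y (m + 1)).ncard) / ((m : ℝ) + 1) := fun m =>
    div_nonneg (Real.log_natCast_nonneg _) (by positivity)
  refine le_antisymm ?_ (Real.iInf_nonneg hnn)
  set V := Fintype.card (Fin n → A)
  set a := Fintype.card A
  have hbd : ∀ m : ℕ, Real.log ((wordsOf Y (m + 1)).ncard) ≤
      (M * Real.log a + V * Real.log ((a + 1 : ℕ) : ℝ)) + V * Real.log ((m : ℝ) + 1) := by
    intro m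
    have hl1 : 0 ≤ Real.log ((m : ℝ) + 1) := Real.log_nonneg (by linarith [m.cast_nonneg (α := ℝ)])
    have hl2 := Real.log_natCast_nonneg (a + 1)
    have hl3 := Real.log_natCast_nonneg a
    rcases Nat.eq_zero_or_pos (wordsOf Y (m + 1)).ncard with h0 | hpos
    · rw [h0]
      simp only [Nat.cast_zero, Real.log_zero]
      positivity
    have h1 := hY.ncard_wordsOf_le hM hMn hper (m + 1)
    have ha : 0 < a ^ M := by
      by_contra hc
      have : a ^ M = 0 := by omega
      change _ ≤ a ^ M * _ at h1
      rw [this] at h1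
      omega
    have h2 : (wordsOf Y (m + 1)).ncard ≤ a ^ M * ((m + 1) * (a + 1)) ^ V := by
      refine h1.trans (Nat.mul_le_mul_left _ (Nat.pow_le_pow_left ?_ _))
      change (m + 1) * a + 1 ≤ _
      nlinarith
    calc Real.log ((wordsOf Y (m + 1)).ncard)
        ≤ Real.log ((a ^ M * ((m + 1) * (a + 1)) ^ V : ℕ) : ℝ) :=
          Real.log_le_log (by exact_mod_cast hpos) (by exact_mod_cast h2)
      _ = _ := by
          have ha' : ((a : ℝ) ^ M) ≠ 0 := by exact_mod_cast ha.ne'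
          push_cast
          rw [Real.log_mul ha' (by positivity), Real.log_pow, Real.log_pow,
            Real.log_mul (by positivity) (by positivity)]
          ring
  have hlim : Tendsto (fun m : ℕ =>
      ((M * Real.log a + V * Real.log ((a + 1 : ℕ) : ℝ)) + V * Real.log ((m : ℝ) + 1)) /
        ((m : ℝ) + 1)) atTop (𝓝 0) := by
    have hm : Tendsto (fun m : ℕ => (m : ℝ) + 1) atTop atTop :=
      tendsto_atTop_add_const_right _ _ tendsto_natCast_atTop_atTop
    have h1 := (Real.isLittleO_log_id_atTop.tendsto_div_nhds_zero).comp hm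
    have h2 := (tendsto_const_nhds (x := (M * Real.log a + V * Real.log ((a + 1 : ℕ) : ℝ)))).div_atTop hm
    have h3 := h2.add (h1.const_mul (V : ℝ))
    simp only [mul_zero, add_zero] at h3
    refine h3.congr fun m => ?_
    simp only [Function.comp, id]
    ring
  refine ge_of_tendsto' hlim fun m => ?_
  refine (ciInf_le ⟨0, ?_⟩ m).trans (div_le_div_of_nonneg_right (hbd m) (by positivity))
  rintro _ ⟨m, rfl⟩
  exact hnn m

end Entropy

section Bernoulli

lemma prod_bernoulli_nonneg {E : Type*} [Fintype E] {α : ℝ} (h0 : 0 ≤ α) (h1 : α ≤ 1) (ω : E → Bool) :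
    0 ≤ ∏ e, (if ω e = true then α else 1 - α) := by
  refine Finset.prod_nonneg fun e _ => ?_
  split_ifs <;> linarith

variable {E : Type*} [Fintype E] [DecidableEq E]

lemma bprob_eq (α : ℝ) (Ev : Set (E → Bool)) :
    bprob α Ev = ∑ ω : E → Bool, if ω ∈ Ev then ∏ e, (if ω e = true then α else 1 - α) else 0 := by
  unfold bprob
  refine Finset.sum_congr rfl fun ω _ => ?_
  rw [Finset.prod_ite, Finset.prod_const, Finset.prod_const]
  simp only [Bool.not_eq_true]

lemma bprob_forall (α : ℝ) (W : Finset E) :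
    bprob α {ω : E → Bool | ∀ e ∈ W, ω e = true} = α ^ W.card := by
  have h := Finset.prod_univ_sum (fun _ : E => (Finset.univ : Finset Bool))
    (fun e b => if b = true then α else if e ∈ W then 0 else 1 - α)
  rw [bprob_eq]
  calc _ = ∑ ω : E → Bool, ∏ e, (if ω e = true then α else if e ∈ W then 0 else 1 - α) := by
        refine Finset.sum_congr rfl fun ω _ => ?_
        by_cases hω : ω ∈ {ω : E → Bool | ∀ e ∈ W, ω e = true}
        · rw [if_pos hω]
          refine Finset.prod_congr rfl fun e _ => ?_
          by_cases he : ω e = true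
          · simp [he]
          · have : e ∉ W := fun hW => he (hω e hW)
            simp [he, this]
        · rw [if_neg hω]
          obtain ⟨e, he, hne⟩ : ∃ e ∈ W, ω e ≠ true := by
            by_contra hc
            push Not at hc
            exact hω hc
          exact (Finset.prod_eq_zero (Finset.mem_univ e) (by rw [if_neg hne, if_pos he])).symm
    _ = ∏ e, (if e ∈ W then α else 1) := by
        rw [Fintype.piFinset_univ] at h
        rw [← h]
        refine Finset.prod_congr rfl fun e _ => ?_
        by_cases he : e ∈ W <;> simp [he]
    _ = α ^ W.card := by simp

lemma bprob_mono {α : ℝ} (h0 : 0 ≤ α) (h1 : α ≤ 1) {S T : Set (E → Bool)} (h : S ⊆ T) :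
    bprob α S ≤ bprob α T := by
  rw [bprob_eq, bprob_eq]
  refine Finset.sum_le_sum fun ω _ => ?_
  have := prod_bernoulli_nonneg h0 h1 ω
  by_cases hS : ω ∈ S
  · rw [if_pos hS, if_pos (h hS)]
  · rw [if_neg hS]
    split_ifs <;> simp [this]

lemma bprob_univ (α : ℝ) : bprob α (Set.univ : Set (E → Bool)) = 1 := by
  simpa using bprob_forall α (∅ : Finset E)

lemma bprob_biUnion_le {ι : Type*} {α : ℝ} (h0 : 0 ≤ α) (h1 : α ≤ 1) (s : Finset ι)
    (S : ι → Set (E → Bool)) : bprob α (⋃ i ∈ s, S i) ≤ ∑ i ∈ s, bprob α (S i) := by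
  simp only [bprob_eq]
  rw [Finset.sum_comm]
  refine Finset.sum_le_sum fun ω _ => ?_
  have hn := prod_bernoulli_nonneg h0 h1 ω
  have hnn : ∀ i ∈ s, 0 ≤ if ω ∈ S i then ∏ e, (if ω e = true then α else 1 - α) else 0 := by
    intro i _
    split_ifs <;> simp [hn]
  by_cases h : ω ∈ ⋃ i ∈ s, S i
  · rw [if_pos h]
    simp only [Set.mem_iUnion] at h
    obtain ⟨i, hi, hω⟩ := h
    exact (le_of_eq (if_pos hω).symm).trans (Finset.single_le_sum hnn hi)
  · rw [if_neg h]
    exact Finset.sum_nonneg hnn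

lemma bprob_union_le {α : ℝ} (h0 : 0 ≤ α) (h1 : α ≤ 1) (S T : Set (E → Bool)) :
    bprob α (S ∪ T) ≤ bprob α S + bprob α T := by
  have := bprob_biUnion_le h0 h1 Finset.univ (fun b : Bool => cond b S T)
  simpa [Set.union_eq_iUnion] using this

lemma abs_bprob_sub_le {α : ℝ} (h0 : 0 ≤ α) (h1 : α ≤ 1) {S T B : Set (E → Bool)}
    (h : ∀ ω ∉ B, ω ∈ S ↔ ω ∈ T) : |bprob α S - bprob α T| ≤ bprob α B := by
  have hS : bprob α S ≤ bprob α T + bprob α B :=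
    (bprob_mono h0 h1 fun ω hω => by
      by_cases hB : ω ∈ B
      · exact Or.inr hB
      · exact Or.inl ((h ω hB).1 hω)).trans (bprob_union_le h0 h1 T B)
  have hT : bprob α T ≤ bprob α S + bprob α B :=
    (bprob_mono h0 h1 fun ω hω => by
      by_cases hB : ω ∈ B
      · exact Or.inr hB
      · exact Or.inl ((h ω hB).2 hω)).trans (bprob_union_le h0 h1 S B)
  rw [abs_le]
  constructor <;> linarith

open Polynomial in
lemma sum_bprob_generating {ι : Type*} (α : ℝ) (F : Finset ι) (W : ι → Finset E)
    (hd : (F : Set ι).PairwiseDisjoint W) :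
    ∑ ω : E → Bool, C (∏ e, (if ω e = true then α else 1 - α)) *
        X ^ (F.filter fun i => ∀ e ∈ W i, ω e = true).card =
      ∏ i ∈ F, (1 + (X - 1) * C (α ^ (W i).card)) := by
  have h1 : ∀ ω : E → Bool, (X : ℝ[X]) ^ (F.filter fun i => ∀ e ∈ W i, ω e = true).card =
      ∑ S ∈ F.powerset, (X - 1) ^ S.card *
        (if ω ∈ {ω : E → Bool | ∀ e ∈ S.biUnion W, ω e = true} then 1 else 0) := by
    intro ω
    rw [← Finset.prod_const, Finset.prod_filter]
    have : ∀ i, (if ∀ e ∈ W i, ω e = true then (X : ℝ[X]) else 1) =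
        1 + (X - 1) * (if ∀ e ∈ W i, ω e = true then 1 else 0) := by
      intro i
      split_ifs <;> ring
    simp only [this]
    rw [Finset.prod_one_add]
    refine Finset.sum_congr rfl fun S _ => ?_
    rw [Finset.prod_mul_distrib, Finset.prod_const]
    congr 1
    rw [Finset.prod_boole]
    refine if_congr ?_ rfl rfl
    simp only [Set.mem_ofPred_eq, Finset.mem_biUnion]
    constructor
    · rintro h e ⟨i, hi, he⟩
      exact h i hi e he
    · intro h i hi e he
      exact h e ⟨i, hi, he⟩
  simp only [h1, Finset.mul_sum]
  rw [Finset.sum_comm, Finset.prod_one_add]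
  refine Finset.sum_congr rfl fun S hS => ?_
  have hSF := Finset.mem_powerset.1 hS
  rw [Finset.prod_mul_distrib, Finset.prod_const, ← map_prod, Finset.prod_pow_eq_pow_sum,
    ← Finset.card_biUnion fun i hi j hj hij => hd (hSF hi) (hSF hj) hij, ← bprob_forall, bprob_eq,
    map_sum, Finset.mul_sum]
  refine Finset.sum_congr rfl fun ω _ => ?_
  split_ifs <;> simp [mul_comm]

open Polynomial in
/-- The law of the number of fully open blocks, for disjoint blocks. -/
lemma bprob_card_eq {ι : Type*} (α : ℝ) (F : Finset ι) (W : ι → Finset E)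
    (hd : (F : Set ι).PairwiseDisjoint W) (hW : ∀ i ∈ F, α ^ (W i).card ≠ 1) (k : ℕ) :
    bprob α {ω : E → Bool | (F.filter fun i => ∀ e ∈ W i, ω e = true).card = k} =
      (∏ i ∈ F, (1 - α ^ (W i).card)) *
        ∑ S ∈ F.powersetCard k, ∏ i ∈ S, α ^ (W i).card / (1 - α ^ (W i).card) := by
  have h := congrArg (fun p => coeff p k) (sum_bprob_generating α F W hd)
  simp only [finsetSum_coeff, coeff_C_mul_X_pow] at h
  have h2 : ∏ i ∈ F, (1 + (X - 1) * C (α ^ (W i).card)) =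
      C (∏ i ∈ F, (1 - α ^ (W i).card)) * ∑ S ∈ F.powerset,
        C (∏ i ∈ S, α ^ (W i).card / (1 - α ^ (W i).card)) * X ^ S.card := by
    have : ∀ S ∈ F.powerset, C (∏ i ∈ S, α ^ (W i).card / (1 - α ^ (W i).card)) * X ^ S.card =
        ∏ i ∈ S, (C (α ^ (W i).card / (1 - α ^ (W i).card)) * X) := by
      intro S _
      rw [Finset.prod_mul_distrib, Finset.prod_const, map_prod]
    rw [Finset.sum_congr rfl this, ← Finset.prod_one_add, map_prod, ← Finset.prod_mul_distrib]
    refine Finset.prod_congr rfl fun i hi => ?_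
    have hne : 1 - α ^ (W i).card ≠ 0 := sub_ne_zero.2 (hW i hi).symm
    rw [mul_add, ← mul_assoc, ← map_mul, mul_div_cancel₀ _ hne, map_sub, map_one]
    ring
  rw [h2, coeff_C_mul, finsetSum_coeff] at h
  simp only [coeff_C_mul_X_pow] at h
  rw [bprob_eq]
  convert h using 1
  · refine Finset.sum_congr rfl fun ω _ => ?_
    by_cases hk : (F.filter fun i => ∀ e ∈ W i, ω e = true).card = k
    · rw [if_pos hk.symm, if_pos]
      exact hk
    · rw [if_neg (Ne.symm hk), if_neg]
      exact hk
  · congr 1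
    rw [← Finset.sum_filter, Finset.powersetCard_eq_filter]
    refine Finset.sum_congr ?_ fun _ _ => rfl
    ext S
    simp [eq_comm]

end Bernoulli

section ElementarySymmetric

variable {ι : Type*} {a : ι → ℝ}

lemma esymm_succ_mul_le (ha : ∀ i, 0 ≤ a i) (F : Finset ι) (k : ℕ) :
    ((k : ℝ) + 1) * ∑ S ∈ F.powersetCard (k + 1), ∏ i ∈ S, a i ≤
      (∑ i ∈ F, a i) * ∑ S ∈ F.powersetCard k, ∏ i ∈ S, a i := by
  have hnn : ∀ (F : Finset ι) (k : ℕ), 0 ≤ ∑ S ∈ F.powersetCard k, ∏ i ∈ S, a i := fun F k =>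
    Finset.sum_nonneg fun S _ => Finset.prod_nonneg fun i _ => ha i
  have hins : ∀ (F : Finset ι) (s : ι), s ∉ F → ∀ k : ℕ,
      ∑ S ∈ (insert s F).powersetCard (k + 1), ∏ i ∈ S, a i =
        ∑ S ∈ F.powersetCard (k + 1), ∏ i ∈ S, a i +
          a s * ∑ S ∈ F.powersetCard k, ∏ i ∈ S, a i := by
    intro F s hs k
    have hsub : ∀ S ∈ F.powersetCard k, s ∉ S := fun S hS h =>
      hs ((Finset.mem_powersetCard.1 hS).1 h)
    rw [Finset.powersetCard_succ_insert hs, Finset.sum_union, Finset.sum_image, Finset.mul_sum]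
    · congr 1
      exact Finset.sum_congr rfl fun S hS => Finset.prod_insert (hsub S hS)
    · intro S hS S' hS' h
      rw [← Finset.erase_insert (hsub S hS), ← Finset.erase_insert (hsub S' hS')]
      exact congrArg (fun T => T.erase s) h
    · rw [Finset.disjoint_left]
      intro S hS hS'
      obtain ⟨T, -, rfl⟩ := Finset.mem_image.1 hS'
      exact hs ((Finset.mem_powersetCard.1 hS).1 (Finset.mem_insert_self s T))
  induction F using Finset.induction_on generalizing k with
  | empty =>
    rw [Finset.powersetCard_eq_empty.2 (by simp)]
    simp
  | insert s F hs ih =>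
    rw [hins F s hs, Finset.sum_insert hs]
    have hA : 0 ≤ ∑ i ∈ F, a i := Finset.sum_nonneg fun i _ => ha i
    cases k with
    | zero =>
      have := ih 0
      simp only [zero_add, Nat.cast_zero, one_mul, Finset.powersetCard_zero, Finset.sum_singleton,
        Finset.prod_empty, mul_one] at this ⊢
      linarith
    | succ k =>
      rw [hins F s hs]
      have h1 := ih (k + 1)
      have h2 := mul_le_mul_of_nonneg_left (ih k) (ha s)
      have h3 := mul_nonneg (mul_nonneg (ha s) (ha s)) (hnn F k)
      push_cast at h1 h2 ⊢
      nlinarith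

lemma summable_subset_prod (ha : ∀ i, 0 ≤ a i) (hs : Summable a) (k : ℕ) :
    Summable fun S : {S : Finset ι // S.card = k} => ∏ i ∈ S.1, a i :=
  (summable_finsetProd_of_summable_nonneg ha hs).comp_injective Subtype.val_injective

lemma tendsto_esymm (ha : ∀ i, 0 ≤ a i) (hs : Summable a) (k : ℕ) :
    Tendsto (fun F : Finset ι => ∑ S ∈ F.powersetCard k, ∏ i ∈ S, a i) atTop
      (𝓝 (∑' S : {S : Finset ι // S.card = k}, ∏ i ∈ S.1, a i)) := by
  have h := (summable_subset_prod ha hs k).hasSum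
  have hG : Tendsto (fun F : Finset ι => (F.powersetCard k).subtype fun S => S.card = k)
      atTop atTop := by
    refine tendsto_atTop_finset_of_monotone ?_ ?_
    · intro F F' hFF S hS
      simp only [Finset.mem_subtype, Finset.mem_powersetCard] at hS ⊢
      exact ⟨hS.1.trans hFF, hS.2⟩
    · rintro ⟨S, hS⟩
      exact ⟨S, by simp [Finset.mem_subtype, Finset.mem_powersetCard, hS]⟩
  refine (h.comp hG).congr fun F => ?_
  exact (Finset.sum_subtype_of_mem (fun S : Finset ι => ∏ i ∈ S, a i)
    fun S hS => (Finset.mem_powersetCard.1 hS).2)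

lemma tsum_esymm_succ_mul_le (ha : ∀ i, 0 ≤ a i) (hs : Summable a) (k : ℕ) :
    ((k : ℝ) + 1) * ∑' S : {S : Finset ι // S.card = k + 1}, ∏ i ∈ S.1, a i ≤
      (∑' i, a i) * ∑' S : {S : Finset ι // S.card = k}, ∏ i ∈ S.1, a i :=
  le_of_tendsto_of_tendsto' ((tendsto_esymm ha hs (k + 1)).const_mul _)
    (Tendsto.mul hs.hasSum (tendsto_esymm ha hs k)) (esymm_succ_mul_le ha · k)

lemma exists_succ_le_mul {T : ℕ → ℝ} (hT : ∀ k, 0 ≤ T k) {s : ℝ}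
    (h : ∀ k : ℕ, ((k : ℝ) + 1) * T (k + 1) ≤ s * T k) {δ : ℝ} (hδ : 0 < δ) :
    ∃ k₀ : ℕ, ∀ k ≥ k₀, T (k + 1) ≤ δ * T k := by
  obtain ⟨k₀, hk₀⟩ := exists_nat_ge (s / δ)
  refine ⟨k₀, fun k hk => ?_⟩
  have hk' : (k₀ : ℝ) ≤ k := by exact_mod_cast hk
  have h1 : s ≤ δ * ((k : ℝ) + 1) := by
    rw [div_le_iff₀ hδ] at hk₀
    nlinarith
  have h2 : ((k : ℝ) + 1) * T (k + 1) ≤ ((k : ℝ) + 1) * (δ * T k) := by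
    nlinarith [h k, mul_le_mul_of_nonneg_right h1 (hT k)]
  exact le_of_mul_le_mul_left h2 (by positivity)

lemma summable_pow_mul_of_forall_exists {T : ℕ → ℝ} (hT : ∀ k, 0 ≤ T k)
    (h : ∀ δ : ℝ, 0 < δ → ∃ k₀ : ℕ, ∀ k ≥ k₀, T (k + 1) ≤ δ * T k) (r : ℕ) :
    Summable fun k : ℕ => (k : ℝ) ^ r * T k := by
  obtain ⟨k₀, hk₀⟩ := h ((1 / 2) ^ (r + 1)) (by positivity)
  refine summable_of_ratio_norm_eventually_le (r := 1 / 2) (by norm_num) ?_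
  filter_upwards [eventually_ge_atTop (max k₀ 1)] with k hk
  have h1 : (1 : ℝ) ≤ k := by exact_mod_cast (le_max_right _ _).trans hk
  have h2 := hk₀ k ((le_max_left _ _).trans hk)
  have := hT k
  have := hT (k + 1)
  rw [Real.norm_of_nonneg (by positivity), Real.norm_of_nonneg (by positivity)]
  calc ((k + 1 : ℕ) : ℝ) ^ r * T (k + 1)
      ≤ (2 * k) ^ r * ((1 / 2) ^ (r + 1) * T k) := by
        gcongr
        push_cast
        linarith
    _ = 1 / 2 * (k ^ r * T k) := by
        rw [mul_pow, pow_succ]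
        have : (2 : ℝ) ^ r * (1 / 2) ^ r = 1 := by rw [← mul_pow]; norm_num
        linear_combination (k ^ r * (1 / 2) * T k) * this

end ElementarySymmetric

section Zeta

variable {A : Type*}

lemma ncard_range_iterate {B : Type*} {f : B → B} {x : B} {p : ℕ} (hp : 1 ≤ p)
    (hx : f^[p] x = x) :
    (Set.range fun m : ℕ => f^[m] x).ncard = Function.minimalPeriod f x := by
  have hpos : 0 < Function.minimalPeriod f x :=
    Function.minimalPeriod_pos_of_mem_periodicPts ⟨p, hp, hx⟩
  have himg : (Set.range fun m : ℕ => f^[m] x) =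
      (fun m : ℕ => f^[m] x) '' Set.Iio (Function.minimalPeriod f x) := by
    ext z
    constructor
    · rintro ⟨m, rfl⟩
      exact ⟨m % Function.minimalPeriod f x, Nat.mod_lt _ hpos,
        Function.iterate_mod_minimalPeriod_eq⟩
    · rintro ⟨m, -, rfl⟩
      exact ⟨m, rfl⟩
  rw [himg, Set.InjOn.ncard_image]
  · simp [Set.ncard_eq_toFinset_card']
  · exact Function.iterate_injOn_Iio_minimalPeriod

lemma IsPeriodicOrbit.ncard_eq {X O : Set (ℤ → A)} (hO : IsPeriodicOrbit X O) {y : ℤ → A}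
    (hy : y ∈ O) : O.ncard = Function.minimalPeriod shiftMap y := by
  obtain ⟨p, hp, hper⟩ := hO.exists_period
  rw [hO.eq_range hy]
  exact ncard_range_iterate hp ((shiftMap_iterate_eq_iff p y).2 (hper y hy))

lemma IsPeriodicOrbit.iterate_eq_iff {X O : Set (ℤ → A)} (hO : IsPeriodicOrbit X O) {y : ℤ → A}
    (hy : y ∈ O) (p : ℕ) : shiftMap^[p] y = y ↔ O.ncard ∣ p := by
  rw [hO.ncard_eq hy]
  exact Function.isPeriodicPt_iff_minimalPeriod_dvd

lemma IsPeriodicOrbit.ncard_pos {X O : Set (ℤ → A)} (hO : IsPeriodicOrbit X O) :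
    0 < O.ncard := by
  obtain ⟨y, hy⟩ := hO.nonempty
  obtain ⟨p, hp, hper⟩ := hO.exists_period
  have h := (hO.iterate_eq_iff hy p).1 ((shiftMap_iterate_eq_iff p y).2 (hper y hy))
  exact Nat.pos_of_dvd_of_pos h hp

lemma injective_subword_fixed (X : Set (ℤ → A)) {p : ℕ} (hp : 1 ≤ p) :
    Function.Injective fun x : {x : ℤ → A // x ∈ X ∧ shiftMap^[p] x = x} =>
      subword x.1 0 p := fun x y h => Subtype.ext <|
  eq_of_subword_eq hp le_rfl ((shiftMap_iterate_eq_iff p _).1 x.2.2)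
    ((shiftMap_iterate_eq_iff p _).1 y.2.2) h

lemma finite_fixed [Finite A] (X : Set (ℤ → A)) {p : ℕ} (hp : 1 ≤ p) :
    Finite {x : ℤ → A // x ∈ X ∧ shiftMap^[p] x = x} :=
  Finite.of_injective _ (injective_subword_fixed X hp)

lemma periodicCount_le [Finite A] (X : Set (ℤ → A)) {p : ℕ} (hp : 1 ≤ p) :
    periodicCount X p ≤ (wordsOf X p).ncard := by
  rw [← Nat.card_coe_set_eq]
  refine Nat.card_le_card_of_injective
    (fun x => ⟨subword x.1 0 p, x.1, x.2.1, 0, fun _ => rfl⟩) fun x y h => ?_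
  exact injective_subword_fixed X hp (Subtype.ext_iff.1 h)

lemma summable_periodicCount [Finite A] {X : Set (ℤ → A)} {lam α : ℝ} (hlam : 1 ≤ lam)
    (hent : Tendsto (fun n : ℕ => Real.log ((wordsOf X n).ncard) / (n : ℝ))
      atTop (𝓝 (Real.log lam))) (hα0 : 0 ≤ α) (hα1 : α < 1 / lam) :
    Summable fun p : ℕ => (periodicCount X (p + 1) : ℝ) * α ^ (p + 1) := by
  have hlam0 : 0 < lam := by linarith
  obtain ⟨β, hβ1, hβ2⟩ : ∃ β, lam < β ∧ α * β < 1 := by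
    rcases hα0.eq_or_lt with rfl | hpos
    · exact ⟨lam + 1, by linarith, by simp⟩
    · have : lam < 1 / α := by rwa [lt_one_div hlam0 hpos]
      obtain ⟨β, h1, h2⟩ := exists_between this
      exact ⟨β, h1, by rwa [lt_div_iff₀ hpos, mul_comm] at h2⟩
  have hβ0 : 0 < β := by linarith
  have hev : ∀ᶠ p : ℕ in atTop, ((periodicCount X p : ℝ)) * α ^ p ≤ (α * β) ^ p := by
    filter_upwards [hent.eventually (gt_mem_nhds (Real.log_lt_log hlam0 hβ1)),
      eventually_ge_atTop 1] with p hp hp1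
    have hp0 : (0 : ℝ) < p := by exact_mod_cast hp1
    have h1 : (periodicCount X p : ℝ) ≤ (wordsOf X p).ncard := by
      exact_mod_cast periodicCount_le X hp1
    have h2 : ((wordsOf X p).ncard : ℝ) ≤ β ^ p := by
      rcases Nat.eq_zero_or_pos (wordsOf X p).ncard with h0 | hpos
      · rw [h0]; simp; positivity
      · rw [div_lt_iff₀ hp0, mul_comm, ← Real.log_pow] at hp
        exact ((Real.log_lt_log_iff (by exact_mod_cast hpos) (by positivity)).1 hp).le
    rw [mul_pow, mul_comm]
    exact mul_le_mul_of_nonneg_left (h1.trans h2) (by positivity)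
  have hgeo : Summable fun p : ℕ => (α * β) ^ p :=
    summable_geometric_of_lt_one (by positivity) hβ2
  have hsum : Summable fun p : ℕ => (periodicCount X p : ℝ) * α ^ p :=
    hgeo.of_norm_bounded_eventually_nat (by
      filter_upwards [hev] with p hp
      rwa [Real.norm_of_nonneg (by positivity)])
  exact (summable_nat_add_iff 1).2 hsum

lemma tsum_dvd_pow_div {α : ℝ} (hα0 : 0 ≤ α) (hα1 : α < 1) {q : ℕ} (hq : 0 < q) :
    (q : ENNReal) * ∑' p : ℕ, (if q ∣ p + 1 then ENNReal.ofReal (α ^ (p + 1) / (p + 1)) else 0) =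
      ENNReal.ofReal (-Real.log (1 - α ^ q)) := by
  have hinj : Function.Injective fun m : ℕ => q * (m + 1) - 1 := by
    intro m m' h
    have h1 : 0 < q * (m + 1) := by positivity
    have h2 : 0 < q * (m' + 1) := by positivity
    have h3 : q * (m + 1) = q * (m' + 1) := by simp only at h; omega
    have := Nat.eq_of_mul_eq_mul_left hq h3
    omega
  have hsucc : ∀ m : ℕ, q * (m + 1) - 1 + 1 = q * (m + 1) := fun m =>
    Nat.sub_add_cancel (by have : 0 < q * (m + 1) := by positivity
                           omega)
  have hαq0 : 0 ≤ α ^ q := by positivity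
  have hαq : α ^ q < 1 := pow_lt_one₀ hα0 hα1 hq.ne'
  have hlog := Real.hasSum_pow_div_log_of_abs_lt_one (x := α ^ q) (by rwa [abs_of_nonneg hαq0])
  rw [← hinj.tsum_eq, ← ENNReal.tsum_mul_left, ← hlog.tsum_eq,
    ENNReal.ofReal_tsum_of_nonneg (fun m => by positivity) hlog.summable]
  · refine tsum_congr fun m => ?_
    have hc : (((q * (m + 1) - 1 : ℕ) : ℝ) + 1) = q * (m + 1) := by
      exact_mod_cast congrArg (Nat.cast (R := ℝ)) (hsucc m)
    rw [hsucc, hc, if_pos (dvd_mul_right q _), ← ENNReal.ofReal_natCast,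
      ← ENNReal.ofReal_mul (by positivity)]
    congr 1
    have : (q : ℝ) ≠ 0 := by positivity
    field_simp
    rw [← pow_mul]
  · intro p hp
    have hd : q ∣ p + 1 := by
      by_contra h
      exact hp (if_neg h)
    obtain ⟨c, hc⟩ := hd
    have hc0 : c ≠ 0 := by rintro rfl; simp at hc
    refine ⟨c - 1, ?_⟩
    simp only
    rw [Nat.sub_add_cancel (by omega), ← hc]
    rfl

/-- The Euler product of the Artin–Mazur zeta function, in logarithmic form. -/
lemma tsum_periodicCount_eq [Finite A] {X : Set (ℤ → A)} {n : ℕ} (hX : StepClosed X n) {α : ℝ}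
    (hα0 : 0 ≤ α) (hα1 : α < 1) :
    ∑' p : ℕ, ENNReal.ofReal ((periodicCount X (p + 1) : ℝ) / (p + 1) * α ^ (p + 1)) =
      ∑' O : {O : Set (ℤ → A) // IsPeriodicOrbit X O},
        ENNReal.ofReal (-Real.log (1 - α ^ O.1.ncard)) := by
  let g : (ℤ → A) → ℕ → ENNReal := fun x p =>
    if x ∈ X ∧ shiftMap^[p + 1] x = x then ENNReal.ofReal (α ^ (p + 1) / (p + 1)) else 0
  have h1 : ∀ p : ℕ, ENNReal.ofReal ((periodicCount X (p + 1) : ℝ) / (p + 1) * α ^ (p + 1)) =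
      ∑' x, g x p := by
    intro p
    have hfin := finite_fixed X (Nat.succ_pos p)
    have hsub := tsum_subtype {x : ℤ → A | x ∈ X ∧ shiftMap^[p + 1] x = x}
      fun _ => ENNReal.ofReal (α ^ (p + 1) / (p + 1))
    have hg : ∀ x, g x p = Set.indicator {x : ℤ → A | x ∈ X ∧ shiftMap^[p + 1] x = x}
        (fun _ => ENNReal.ofReal (α ^ (p + 1) / (p + 1))) x := fun x => by
      simp only [g, Set.indicator_apply, Set.mem_ofPred_eq]
    rw [tsum_congr hg, ← hsub, ENNReal.tsum_const]
    have hcard : (ENat.card {x : ℤ → A | x ∈ X ∧ shiftMap^[p + 1] x = x} : ENNReal) =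
        (periodicCount X (p + 1) : ENNReal) := by
      have : Finite {x : ℤ → A | x ∈ X ∧ shiftMap^[p + 1] x = x} := hfin
      rw [ENat.card_eq_coe_natCard]
      rfl
    rw [hcard, ← ENNReal.ofReal_natCast, ← ENNReal.ofReal_mul (by positivity)]
    congr 1
    ring
  simp only [h1]
  rw [ENNReal.tsum_comm]
  let e : (Σ O : {O : Set (ℤ → A) // IsPeriodicOrbit X O}, O.1) → (ℤ → A) := fun y => y.2.1
  have he : Function.Injective e := by
    rintro ⟨⟨O, hO⟩, y, hy⟩ ⟨⟨O', hO'⟩, y', hy'⟩ h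
    obtain rfl : y = y' := h
    obtain rfl : O = O' := (hO.eq_range hy).trans (hO'.eq_range hy').symm
    rfl
  rw [← he.tsum_eq, ENNReal.tsum_sigma']
  · refine tsum_congr fun O => ?_
    have hconst : ∀ y : O.1, ∑' p, g (e ⟨O, y⟩) p =
        ∑' p : ℕ, (if O.1.ncard ∣ p + 1 then ENNReal.ofReal (α ^ (p + 1) / (p + 1)) else 0) := by
      intro y
      refine tsum_congr fun p => if_congr ?_ rfl rfl
      rw [and_iff_right (O.2.subset hX y.2)]
      exact O.2.iterate_eq_iff y.2 _
    have hfin : Finite O.1 := Set.finite_of_ncard_pos O.2.ncard_pos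
    rw [tsum_congr hconst, ENNReal.tsum_const, ENat.card_eq_coe_natCard, Nat.card_coe_set_eq]
    exact tsum_dvd_pow_div hα0 hα1 O.2.ncard_pos
  · intro x hx
    obtain ⟨p, hp⟩ : ∃ p, g x p ≠ 0 := by
      by_contra hc
      push Not at hc
      exact hx (ENNReal.tsum_eq_zero.2 hc)
    have hxp : x ∈ X ∧ shiftMap^[p + 1] x = x := by
      by_contra hc
      exact hp (if_neg hc)
    exact ⟨⟨⟨_, x, hxp.1, ⟨p + 1, by omega, hxp.2⟩, rfl⟩, x, 0, rfl⟩, rfl⟩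

lemma hasSum_neg_log [Finite A] {X : Set (ℤ → A)} {n : ℕ} (hX : StepClosed X n) {α : ℝ}
    (hα0 : 0 ≤ α) (hα1 : α < 1)
    (hs : Summable fun p : ℕ => (periodicCount X (p + 1) : ℝ) * α ^ (p + 1)) :
    HasSum (fun O : {O : Set (ℤ → A) // IsPeriodicOrbit X O} => -Real.log (1 - α ^ O.1.ncard))
      (∑' p : ℕ, (periodicCount X (p + 1) : ℝ) / (p + 1) * α ^ (p + 1)) := by
  have hnn : ∀ p : ℕ, 0 ≤ (periodicCount X (p + 1) : ℝ) / (p + 1) * α ^ (p + 1) := fun p => by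
    positivity
  have hs' : Summable fun p : ℕ => (periodicCount X (p + 1) : ℝ) / (p + 1) * α ^ (p + 1) := by
    refine Summable.of_nonneg_of_le hnn (fun p => ?_) hs
    gcongr
    exact div_le_self (by positivity) (by linarith [p.cast_nonneg (α := ℝ)])
  have hlog : ∀ O : {O : Set (ℤ → A) // IsPeriodicOrbit X O},
      0 ≤ -Real.log (1 - α ^ O.1.ncard) := by
    intro O
    have h1 : α ^ O.1.ncard < 1 := pow_lt_one₀ hα0 hα1 O.2.ncard_pos.ne'
    have h0 : 0 ≤ α ^ O.1.ncard := by positivity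
    exact neg_nonneg.2 (Real.log_nonpos (by linarith) (by linarith))
  have h := tsum_periodicCount_eq hX hα0 hα1
  rw [← ENNReal.ofReal_tsum_of_nonneg hnn hs'] at h
  have hsum : Summable fun O : {O : Set (ℤ → A) // IsPeriodicOrbit X O} =>
      -Real.log (1 - α ^ O.1.ncard) := by
    have := ENNReal.summable_toReal (h ▸ ENNReal.ofReal_ne_top)
    refine this.congr fun O => ?_
    exact ENNReal.toReal_ofReal (hlog O)
  rw [← ENNReal.ofReal_tsum_of_nonneg hlog hsum,
    ENNReal.ofReal_eq_ofReal_iff (tsum_nonneg hnn) (tsum_nonneg hlog)] at h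
  rw [h]
  exact hsum.hasSum

lemma tendsto_prod_one_sub [Finite A] {X : Set (ℤ → A)} {n : ℕ} (hX : StepClosed X n) {α : ℝ}
    (hα0 : 0 ≤ α) (hα1 : α < 1)
    (hs : Summable fun p : ℕ => (periodicCount X (p + 1) : ℝ) * α ^ (p + 1)) :
    Tendsto (fun F : Finset {O : Set (ℤ → A) // IsPeriodicOrbit X O} =>
      ∏ O ∈ F, (1 - α ^ O.1.ncard)) atTop (𝓝 (zetaX X α)⁻¹) := by
  have h : Tendsto (fun F : Finset {O : Set (ℤ → A) // IsPeriodicOrbit X O} =>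
      Real.exp (-∑ O ∈ F, -Real.log (1 - α ^ O.1.ncard))) atTop (𝓝 (zetaX X α)⁻¹) := by
    rw [zetaX, ← Real.exp_neg]
    exact (Real.continuous_exp.tendsto _).comp
      (Filter.Tendsto.neg (hasSum_neg_log hX hα0 hα1 hs))
  refine h.congr fun F => ?_
  rw [Finset.sum_neg_distrib, neg_neg, Real.exp_sum]
  refine Finset.prod_congr rfl fun O _ => Real.exp_log ?_
  linarith [pow_lt_one₀ hα0 hα1 O.2.ncard_pos.ne']

lemma summable_orbit_odds [Finite A] {X : Set (ℤ → A)} {n : ℕ} (hX : StepClosed X n) {α : ℝ}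
    (hα0 : 0 ≤ α) (hα1 : α < 1)
    (hs : Summable fun p : ℕ => (periodicCount X (p + 1) : ℝ) * α ^ (p + 1)) :
    Summable fun O : {O : Set (ℤ → A) // IsPeriodicOrbit X O} =>
      α ^ O.1.ncard / (1 - α ^ O.1.ncard) := by
  refine Summable.of_nonneg_of_le (fun O => ?_) (fun O => ?_)
    ((hasSum_neg_log hX hα0 hα1 hs).summable.mul_left (1 - α)⁻¹)
  · have h1 : α ^ O.1.ncard < 1 := pow_lt_one₀ hα0 hα1 O.2.ncard_pos.ne'
    exact div_nonneg (by positivity) (by linarith)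
  · have h1 : α ^ O.1.ncard < 1 := pow_lt_one₀ hα0 hα1 O.2.ncard_pos.ne'
    have h2 : α ^ O.1.ncard ≤ α := pow_le_of_le_one hα0 hα1.le O.2.ncard_pos.ne'
    have h3 := Real.log_le_sub_one_of_pos (show 0 < 1 - α ^ O.1.ncard by linarith)
    have h4 : 0 ≤ α ^ O.1.ncard := by positivity
    rw [div_eq_inv_mul]
    have h5 : (1 - α ^ O.1.ncard)⁻¹ ≤ (1 - α)⁻¹ := inv_anti₀ (by linarith) (by linarith)
    exact mul_le_mul h5 (by linarith) h4 (inv_nonneg.2 (by linarith))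

end Zeta

section LongCycles

variable {A : Type*}

/-- The event that `X_ω` contains a simple cycle of length greater than `K` in the graph of words
of length `n`. -/
def longCycleEvent (X : Set (ℤ → A)) (K n : ℕ) : Set ((Fin n → A) → Bool) :=
  {ω | ∃ x ∈ XRes X ω, ∃ p : ℕ, K < p ∧ Function.Periodic x (p : ℤ) ∧
    ∀ i j : ℕ, i < j → j < p → subword x i n ≠ subword x j n}

lemma bprob_longCycleEvent_le [Fintype A] [DecidableEq A] {X : Set (ℤ → A)} {α : ℝ}
    (hα0 : 0 ≤ α) (hα1 : α ≤ 1)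
    (hs : Summable fun p : ℕ => (periodicCount X (p + 1) : ℝ) * α ^ (p + 1)) (K n : ℕ) :
    bprob α (longCycleEvent X K n) ≤
      ∑' j : ℕ, (periodicCount X (j + K + 1) : ℝ) * α ^ (j + K + 1) := by
  set N := Fintype.card (Fin n → A)
  have hfin : ∀ p : ℕ, {x : ℤ → A | (x ∈ X ∧ shiftMap^[p + 1] x = x) ∧
      ∀ i j : ℕ, i < j → j < p + 1 → subword x i n ≠ subword x j n}.Finite := fun p =>
    Set.Finite.subset (s := {x : ℤ → A | x ∈ X ∧ shiftMap^[p + 1] x = x})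
      (finite_fixed X (Nat.succ_pos p)) fun x hx => hx.1
  let W : ℕ → (ℤ → A) → Finset (Fin n → A) := fun p x =>
    (Finset.range (p + 1)).image fun i : ℕ => subword x i n
  have hinj : ∀ (p : ℕ) (x : ℤ → A),
      (∀ i j : ℕ, i < j → j < p + 1 → subword x i n ≠ subword x j n) →
      (W p x).card = p + 1 := by
    intro p x hx
    rw [Finset.card_image_of_injOn, Finset.card_range]
    intro i hi j hj hij
    simp only [Finset.coe_range, Set.mem_Iio] at hi hj
    rcases lt_trichotomy i j with h | h | h
    · exact absurd hij (hx i j h hj)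
    · exact h
    · exact absurd hij.symm (hx j i h hi)
  have hsub : longCycleEvent X K n ⊆ ⋃ j ∈ Finset.range N, ⋃ x ∈ (hfin (j + K)).toFinset,
      {ω : (Fin n → A) → Bool | ∀ e ∈ W (j + K) x, ω e = true} := by
    rintro ω ⟨x, hx, p, hKp, hper, hw⟩
    obtain ⟨j, rfl⟩ : ∃ j, p = j + K + 1 := ⟨p - K - 1, by omega⟩
    have hle : (W (j + K) x).card ≤ N := Finset.card_le_univ _
    rw [hinj _ x hw] at hle
    simp only [Set.mem_iUnion]
    refine ⟨j, Finset.mem_range.2 (by omega), x, ?_, ?_⟩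
    · rw [Set.Finite.mem_toFinset]
      exact ⟨⟨hx.1, (shiftMap_iterate_eq_iff _ x).2 hper⟩, hw⟩
    · intro e he
      obtain ⟨i, -, rfl⟩ := Finset.mem_image.1 he
      exact hx.2 i
  have hs' : Summable fun j : ℕ => (periodicCount X (j + K + 1) : ℝ) * α ^ (j + K + 1) :=
    (summable_nat_add_iff (f := fun p => (periodicCount X (p + 1) : ℝ) * α ^ (p + 1)) K).2 hs
  calc bprob α (longCycleEvent X K n)
      ≤ ∑ j ∈ Finset.range N, bprob α (⋃ x ∈ (hfin (j + K)).toFinset,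
          {ω : (Fin n → A) → Bool | ∀ e ∈ W (j + K) x, ω e = true}) :=
        (bprob_mono hα0 hα1 hsub).trans (bprob_biUnion_le hα0 hα1 _ _)
    _ ≤ ∑ j ∈ Finset.range N, (periodicCount X (j + K + 1) : ℝ) * α ^ (j + K + 1) := by
        refine Finset.sum_le_sum fun j _ => (bprob_biUnion_le hα0 hα1 _ _).trans ?_
        have h1 : ∀ x ∈ (hfin (j + K)).toFinset,
            bprob α {ω : (Fin n → A) → Bool | ∀ e ∈ W (j + K) x, ω e = true} =
              α ^ (j + K + 1) := by
          intro x hx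
          rw [Set.Finite.mem_toFinset] at hx
          rw [bprob_forall, hinj _ x hx.2]
        rw [Finset.sum_congr rfl h1, Finset.sum_const, nsmul_eq_mul]
        refine mul_le_mul_of_nonneg_right ?_ (by positivity)
        have := finite_fixed X (Nat.succ_pos (j + K))
        have hle := Nat.card_le_card_of_injective
          (fun x : (hfin (j + K)).toFinset => (⟨x.1, ((Set.Finite.mem_toFinset _).1 x.2).1⟩ :
            {x : ℤ → A // x ∈ X ∧ shiftMap^[j + K + 1] x = x}))
          (fun x y h => Subtype.ext (congrArg Subtype.val h :))
        rw [Nat.card_eq_fintype_card, Fintype.card_coe] at hle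
        exact_mod_cast hle
    _ ≤ _ := hs'.sum_le_tsum _ fun j _ => by positivity

lemma periodic_of_notMem_longCycleEvent {X : Set (ℤ → A)} {K n : ℕ} (hX : StepClosed X n)
    (hn : K.factorial ≤ n) {ω : (Fin n → A) → Bool} (hω : ω ∉ longCycleEvent X K n) :
    ∀ z ∈ XRes X ω, ∀ p : ℕ, 1 ≤ p → Function.Periodic z (p : ℤ) →
      Function.Periodic z (K.factorial : ℤ) := by
  intro z hz p hp hzp
  refine (hX.xRes ω).periodic_of_simple (Nat.factorial_pos K) hn ?_ p hp z hz hzp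
  intro y hy q hq hyq hw
  have hqK : q ≤ K := by
    by_contra hc
    exact hω ⟨y, hy, q, by omega, hyq, hw⟩
  exact hyq.of_dvd (Nat.dvd_factorial hq hqK)

lemma finite_orbits_of_period [Finite A] {X : Set (ℤ → A)} {n : ℕ} (hX : StepClosed X n) {M : ℕ}
    (hM : 1 ≤ M) :
    {O : {O : Set (ℤ → A) // IsPeriodicOrbit X O} |
      ∀ y ∈ O.1, Function.Periodic y (M : ℤ)}.Finite := by
  have hfin : {x : ℤ → A | x ∈ X ∧ shiftMap^[M] x = x}.Finite := finite_fixed X hM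
  refine (hfin.finite_subsets.preimage (f := Subtype.val) Subtype.val_injective.injOn).subset ?_
  intro O hO y hy
  exact ⟨O.2.subset hX hy, (shiftMap_iterate_eq_iff M y).2 (hO y hy)⟩

/-- The words of length `n` of the points of `O`, read at the origin. -/
noncomputable def orbitWords [Finite A] (n : ℕ) (O : Set (ℤ → A)) : Finset (Fin n → A) :=
  (Set.toFinite ((fun x => subword x 0 n) '' O)).toFinset

lemma mem_orbitWords [Finite A] {n : ℕ} {O : Set (ℤ → A)} {w : Fin n → A} :
    w ∈ orbitWords n O ↔ ∃ x ∈ O, subword x 0 n = w := by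
  simp [orbitWords]

lemma card_orbitWords [Finite A] {n M : ℕ} (hM : 1 ≤ M) (hMn : M ≤ n) {O : Set (ℤ → A)}
    (hO : ∀ y ∈ O, Function.Periodic y (M : ℤ)) : (orbitWords n O).card = O.ncard := by
  rw [orbitWords, ← Set.ncard_eq_toFinset_card, Set.InjOn.ncard_image]
  intro x hx y hy h
  exact eq_of_subword_eq hM hMn (hO x hx) (hO y hy) h

lemma disjoint_orbitWords [Finite A] {n M : ℕ} (hM : 1 ≤ M) (hMn : M ≤ n)
    {X O O' : Set (ℤ → A)} (hXO : IsPeriodicOrbit X O) (hXO' : IsPeriodicOrbit X O')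
    (hO : ∀ y ∈ O, Function.Periodic y (M : ℤ)) (hO' : ∀ y ∈ O', Function.Periodic y (M : ℤ))
    (hne : O ≠ O') : Disjoint (orbitWords n O) (orbitWords n O') := by
  rw [Finset.disjoint_left]
  intro w hw hw'
  obtain ⟨x, hx, rfl⟩ := mem_orbitWords.1 hw
  obtain ⟨y, hy, hxy⟩ := mem_orbitWords.1 hw'
  obtain rfl := eq_of_subword_eq hM hMn (hO' y hy) (hO x hx) hxy
  exact hne ((hXO.eq_range hx).trans (hXO'.eq_range hy).symm)

lemma IsPeriodicOrbit.subset_xRes_iff [Finite A] {X O : Set (ℤ → A)} {n M : ℕ}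
    (hX : StepClosed X n) (hXO : IsPeriodicOrbit X O) (hM : 1 ≤ M)
    (hO : ∀ y ∈ O, Function.Periodic y (M : ℤ)) (ω : (Fin n → A) → Bool) :
    O ⊆ XRes X ω ↔ ∀ e ∈ orbitWords n O, ω e = true := by
  constructor
  · intro h e he
    obtain ⟨x, hx, rfl⟩ := mem_orbitWords.1 he
    exact (h hx).2 0
  · intro h x hx
    refine ⟨hXO.subset hX hx, fun i => h _ (mem_orbitWords.2 ⟨shiftMap^[(i % M).toNat] x, ?_, ?_⟩)⟩
    · rw [hXO.eq_range hx]
      exact ⟨_, rfl⟩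
    · rw [subword_shiftMap_iterate, subword_eq_iff,
        Int.toNat_of_nonneg (Int.emod_nonneg i (show (M : ℤ) ≠ 0 by omega))]
      intro k _ _
      have hp := (hO x hx).int_mul (i / M) (0 + i % M + k)
      rw [← hp]
      congr 1
      have := Int.emod_add_mul_ediv i M
      simp only [Int.cast_id]
      linarith [mul_comm (M : ℤ) (i / M)]

lemma compCount_xRes_eq [Fintype A] [DecidableEq A] [TopologicalSpace A] [DiscreteTopology A]
    {X : Set (ℤ → A)} {n M : ℕ} (hX : StepClosed X n) (hM : 1 ≤ M) (hMn : M ≤ n)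
    {ω : (Fin n → A) → Bool}
    (hper : ∀ z ∈ XRes X ω, ∀ p : ℕ, 1 ≤ p → Function.Periodic z (p : ℤ) →
      Function.Periodic z (M : ℤ)) :
    compCount (XRes X ω) = ((finite_orbits_of_period hX hM).toFinset.filter
      fun O => ∀ e ∈ orbitWords n O.1, ω e = true).card := by
  rw [(hX.xRes ω).compCount_eq hM hMn hper, ← Fintype.card_coe, ← Nat.card_eq_fintype_card]
  have hmem : ∀ O : {O : Set (ℤ → A) // IsPeriodicOrbit X O},
      O ∈ (finite_orbits_of_period hX hM).toFinset.filter
        (fun O => ∀ e ∈ orbitWords n O.1, ω e = true) ↔ IsPeriodicOrbit (XRes X ω) O.1 := by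
    intro O
    rw [Finset.mem_filter, Set.Finite.mem_toFinset]
    constructor
    · rintro ⟨h1, h2⟩
      exact O.2.of_subset ((O.2.subset_xRes_iff hX hM h1 ω).2 h2)
    · intro h
      have hsub := h.subset (hX.xRes ω)
      obtain ⟨p, hp, hOp⟩ := O.2.exists_period
      have h1 : ∀ y ∈ O.1, Function.Periodic y (M : ℤ) := fun y hy =>
        hper y (hsub hy) p hp (hOp y hy)
      exact ⟨h1, (O.2.subset_xRes_iff hX hM h1 ω).1 hsub⟩
  refine Nat.card_congr ⟨fun O => ⟨⟨O.1, O.2.of_subset ?_⟩, ?_⟩,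
    fun O => ⟨O.1.1, (hmem O.1).1 O.2⟩, fun O => rfl, fun O => rfl⟩
  · exact (O.2.subset (hX.xRes ω)).trans fun x hx => hx.1
  · exact (hmem _).2 O.2

lemma tendsto_of_forall_eventually_abs_sub_le {P Q ε : ℕ → ℝ} {t : ℝ}
    (hQ : Tendsto Q atTop (𝓝 t)) (hε : Tendsto ε atTop (𝓝 0))
    (h : ∀ K, ∀ᶠ n in atTop, |P n - Q K| ≤ ε K) : Tendsto P atTop (𝓝 t) := by
  rw [Metric.tendsto_atTop'] at hQ hε
  refine Metric.tendsto_nhds.2 fun δ hδ => ?_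
  obtain ⟨K₁, hK₁⟩ := hQ (δ / 2) (by positivity)
  obtain ⟨K₂, hK₂⟩ := hε (δ / 2) (by positivity)
  have h1 := hK₁ (max K₁ K₂ + 1) (by omega)
  have h2 := hK₂ (max K₁ K₂ + 1) (by omega)
  rw [Real.dist_eq] at h1 h2
  rw [sub_zero] at h2
  filter_upwards [h (max K₁ K₂ + 1)] with n hn
  rw [Real.dist_eq]
  have h3 := abs_sub_le (P n) (Q (max K₁ K₂ + 1)) t
  have h4 := le_abs_self (ε (max K₁ K₂ + 1))
  linarith

end LongCycles

/-- **Theorem 1.2 (Subcritical phase).**  Let `X` be a nonempty SFT with entropy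
`h(X) = log λ` and let `0 ≤ α < 1/λ`.  Then:
(1) the probability that `X_ω` has zero entropy tends to `1`;
(2) the number `I_n` of irreducible components of `X_ω` converges in
distribution to `I_∞`, where
`ℙ(I_∞ = k) = ζ_X(α)⁻¹ ∑_{S set of periodic orbits, |S| = k} ∏_{γ ∈ S} α^{|γ|}/(1-α^{|γ|})`
(at `k = 0` this value is `ζ_X(α)⁻¹`);
(3) `I_∞` has exponentially decreasing tail, and finite moments of all orders. -/
theorem random_SFT_subcritical {A : Type*} [Fintype A] [DecidableEq A]
    [TopologicalSpace A] [DiscreteTopology A]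
    (X : Set (ℤ → A)) (hSFT : IsSFT X) (hne : X.Nonempty)
    (lam : ℝ) (hlam : 1 ≤ lam)
    (hent : Tendsto (fun n : ℕ => Real.log ((wordsOf X n).ncard) / (n : ℝ))
      atTop (𝓝 (Real.log lam)))
    (α : ℝ) (hα0 : 0 ≤ α) (hα1 : α < 1 / lam)
    (T : ℕ → ℝ)
    (hT : ∀ k : ℕ, T k = (zetaX X α)⁻¹ *
      ∑' S : {S : Finset {O : Set (ℤ → A) // IsPeriodicOrbit X O} // S.card = k},
        ∏ O ∈ S.1, α ^ O.1.ncard / (1 - α ^ O.1.ncard)) :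
    -- (1) zero entropy with probability tending to 1
    (Tendsto
      (fun n : ℕ => bprob α {ω : (Fin n → A) → Bool | subEntropy (XRes X ω) = 0})
      atTop (𝓝 1)) ∧
    -- (2) convergence in distribution of the number of irreducible components
    (T 0 = (zetaX X α)⁻¹ ∧
      ∀ k : ℕ,
        Tendsto
          (fun n : ℕ => bprob α {ω : (Fin n → A) → Bool | compCount (XRes X ω) = k})
          atTop (𝓝 (T k))) ∧
    -- (3) exponentially decreasing tail and finite moments of all orders
    ((∀ δ : ℝ, 0 < δ → ∃ k₀ : ℕ, ∀ k ≥ k₀, T (k + 1) ≤ δ * T k) ∧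
      ∀ r : ℕ, Summable fun k : ℕ => (k : ℝ) ^ r * T k) := by
  have hlam0 : 0 < lam := by linarith
  have hα : α < 1 := hα1.trans_le ((div_le_one hlam0).2 hlam)
  obtain ⟨L, hL⟩ := hSFT.exists_stepClosed
  have hX := hL L le_rfl
  have hs := summable_periodicCount hlam hent hα0 hα1
  have hpow : ∀ O : {O : Set (ℤ → A) // IsPeriodicOrbit X O}, α ^ O.1.ncard < 1 := fun O =>
    pow_lt_one₀ hα0 hα O.2.ncard_pos.ne'
  have ha : ∀ O : {O : Set (ℤ → A) // IsPeriodicOrbit X O},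
      0 ≤ α ^ O.1.ncard / (1 - α ^ O.1.ncard) := fun O =>
    div_nonneg (by positivity) (by linarith [hpow O])
  have hsum := summable_orbit_odds hX hα0 hα hs
  have hzeta : 0 ≤ (zetaX X α)⁻¹ := inv_nonneg.2 (Real.exp_pos _).le
  have hT0 : ∀ k, 0 ≤ T k := by
    intro k
    rw [hT]
    exact mul_nonneg hzeta (tsum_nonneg fun S => Finset.prod_nonneg fun O _ => ha O)
  have htail : ∀ δ : ℝ, 0 < δ → ∃ k₀ : ℕ, ∀ k ≥ k₀, T (k + 1) ≤ δ * T k := by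
    refine fun δ hδ => exists_succ_le_mul hT0
      (s := ∑' O : {O : Set (ℤ → A) // IsPeriodicOrbit X O}, α ^ O.1.ncard / (1 - α ^ O.1.ncard))
      (fun k => ?_) hδ
    have h := mul_le_mul_of_nonneg_left (tsum_esymm_succ_mul_le ha hsum k) hzeta
    rw [hT, hT]
    exact (mul_left_comm _ _ _).le.trans (h.trans (mul_left_comm _ _ _).le)
  have hε : Tendsto (fun K : ℕ =>
      ∑' j : ℕ, (periodicCount X (j + K + 1) : ℝ) * α ^ (j + K + 1)) atTop (𝓝 0) :=
    tendsto_sum_nat_add fun p => (periodicCount X (p + 1) : ℝ) * α ^ (p + 1)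
  refine ⟨?_, ⟨?_, fun k => ?_⟩, htail, summable_pow_mul_of_forall_exists hT0 htail⟩
  · refine tendsto_of_forall_eventually_abs_sub_le tendsto_const_nhds hε fun K => ?_
    filter_upwards [eventually_ge_atTop L, eventually_ge_atTop K.factorial] with n hnL hnK
    rw [← bprob_univ (E := Fin n → A) α]
    refine (abs_bprob_sub_le hα0 hα.le (B := longCycleEvent X K n) fun ω hω => ?_).trans
      (bprob_longCycleEvent_le hα0 hα.le hs K n)
    refine iff_of_true ?_ (Set.mem_univ ω)
    exact ((hL n hnL).xRes ω).subEntropy_eq_zero (Nat.factorial_pos K) hnK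
      (periodic_of_notMem_longCycleEvent (hL n hnL) hnK hω)
  · have h := tendsto_nhds_unique (tendsto_esymm ha hsum 0)
      (tendsto_const_nhds.congr fun F => by simp : Tendsto _ atTop (𝓝 (1 : ℝ)))
    rw [hT, h, mul_one]
  · have hF : Tendsto (fun K : ℕ =>
        (finite_orbits_of_period hX (Nat.factorial_pos K)).toFinset) atTop atTop := by
      refine tendsto_atTop_finset_of_monotone (fun K K' hKK O hO => ?_) fun O => ?_
      · rw [Set.Finite.mem_toFinset] at hO ⊢
        exact fun y hy => (hO y hy).of_dvd (Nat.factorial_dvd_factorial hKK)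
      · obtain ⟨p, hp, hO⟩ := O.2.exists_period
        refine ⟨p, ?_⟩
        rw [Set.Finite.mem_toFinset]
        exact fun y hy => (hO y hy).of_dvd (Nat.dvd_factorial hp le_rfl)
    have hQ := ((tendsto_prod_one_sub hX hα0 hα hs).mul (tendsto_esymm ha hsum k)).comp hF
    rw [← hT] at hQ
    refine tendsto_of_forall_eventually_abs_sub_le hQ hε fun K => ?_
    filter_upwards [eventually_ge_atTop L, eventually_ge_atTop K.factorial] with n hnL hnK
    set F := (finite_orbits_of_period hX (Nat.factorial_pos K)).toFinset with hFdef
    have hper : ∀ O ∈ F, ∀ y ∈ O.1, Function.Periodic y (K.factorial : ℤ) := fun O hO => by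
      rw [hFdef, Set.Finite.mem_toFinset] at hO
      exact hO
    have hcard : ∀ O ∈ F, (orbitWords n O.1).card = O.1.ncard := fun O hO =>
      card_orbitWords (Nat.factorial_pos K) hnK (hper O hO)
    have hlaw := bprob_card_eq α F (fun O => orbitWords n O.1)
      (fun O hO O' hO' hne => disjoint_orbitWords (Nat.factorial_pos K) hnK O.2 O'.2 (hper O hO)
        (hper O' hO') fun h => hne (Subtype.ext h))
      (fun O hO => by rw [hcard O hO]; exact (hpow O).ne) k
    rw [Finset.prod_congr rfl fun O hO => by rw [hcard O hO], Finset.sum_congr rfl fun S hS =>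
      Finset.prod_congr rfl fun O hO => by
        rw [hcard O ((Finset.mem_powersetCard.1 hS).1 hO)]] at hlaw
    simp only [Function.comp]
    rw [← hlaw]
    refine (abs_bprob_sub_le hα0 hα.le (B := longCycleEvent X K n) fun ω hω => ?_).trans
      (bprob_longCycleEvent_le hα0 hα.le hs K n)
    simp only [Set.mem_ofPred_eq]
    rw [compCount_xRes_eq (hL n hnL) (Nat.factorial_pos K) hnK
      (periodic_of_notMem_longCycleEvent (hL n hnL) hnK hω)]
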